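/- Let K be a field and R the subalgebra of K^ω of eventually constant sequences. Then the class of R-projective R-modules is closed under submodules: every submodule of an R-projective module is R-projective. -/

import Mathlib

/-- The unital `K`-subalgebra of `K^ω` consisting of all eventually constant sequences. -/
def evConst (K : Type*) [Field K] : Subalgebra K (ℕ → K) where
  carrier := {x | ∃ (N : ℕ) (c : K), ∀ n, N ≤ n → x n = c}
  add_mem' := by
    rintro x y ⟨N, c, hN⟩ ⟨M, d, hM⟩
    exact ⟨max N M, c + d, fun n hn => by
      simp [Pi.add_apply, hN n (le_trans (le_max_left N M) hn),
        hM n (le_trans (le_max_right N M) hn)]⟩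
  mul_mem' := by
    rintro x y ⟨N, c, hN⟩ ⟨M, d, hM⟩
    exact ⟨max N M, c * d, fun n hn => by
      simp [Pi.mul_apply, hN n (le_trans (le_max_left N M) hn),
        hM n (le_trans (le_max_right N M) hn)]⟩
  algebraMap_mem' := fun a => ⟨0, a, fun n _ => rfl⟩

/-- The ring of eventually constant sequences in `K^ω`, as a type. -/
def EvRing (K : Type*) [Field K] : Type _ := evConst K

instance (K : Type*) [Field K] : CommRing (EvRing K) :=
  inferInstanceAs (CommRing (evConst K))

instance (K : Type*) [Field K] : Algebra K (EvRing K) :=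
  inferInstanceAs (Algebra K (evConst K))

/-- The underlying sequence of an element of `EvRing K`. -/
def EvRing.seq {K : Type*} [Field K] (x : EvRing K) : ℕ → K :=
  Subtype.val (p := fun x => x ∈ evConst K) x

/-- The idempotent `e i ∈ EvRing K` whose `i`-th component is `1` and all
other components are `0`. -/
def evIdem (K : Type*) [Field K] (i : ℕ) : EvRing K :=
  (⟨fun n => if n = i then 1 else 0, ⟨i + 1, 0, fun n hn => if_neg (by omega)⟩⟩ :
    evConst K)

/-- The socle of a module: the sum of all its simple submodules. -/
def moduleSocle (R : Type*) [Ring R] (M : Type*) [AddCommGroup M] [Module R M] :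
    Submodule R M :=
  sSup {p : Submodule R M | IsSimpleModule R p}

/-- A module `M` over a commutative ring `R` is `R`-projective if for every ideal `I` of `R`,
every `R`-homomorphism `M → R/I` factors through the canonical projection `R → R/I`. -/
def IsRProjective (R : Type*) [CommRing R] (M : Type*) [AddCommGroup M] [Module R M] : Prop :=
  ∀ (I : Ideal R) (f : M →ₗ[R] R ⧸ I), ∃ g : M →ₗ[R] R, f = (Submodule.mkQ I).comp g

theorem EvRing.ext' {K : Type*} [Field K] {x y : EvRing K} (h : ∀ n, x.seq n = y.seq n) :
    x = y := Subtype.ext (funext h)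

theorem EvRing.seq_add {K : Type*} [Field K] (x y : EvRing K) (n : ℕ) :
    (x + y).seq n = x.seq n + y.seq n := rfl

theorem EvRing.seq_mul {K : Type*} [Field K] (x y : EvRing K) (n : ℕ) :
    (x * y).seq n = x.seq n * y.seq n := rfl

theorem EvRing.seq_sub {K : Type*} [Field K] (x y : EvRing K) (n : ℕ) :
    (x - y).seq n = x.seq n - y.seq n := rfl

theorem EvRing.seq_zero {K : Type*} [Field K] (n : ℕ) :
    (0 : EvRing K).seq n = 0 := rfl

theorem EvRing.seq_one {K : Type*} [Field K] (n : ℕ) :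
    (1 : EvRing K).seq n = 1 := rfl

theorem EvRing.exists_const {K : Type*} [Field K] (x : EvRing K) :
    ∃ (N : ℕ) (c : K), ∀ n, N ≤ n → x.seq n = c := x.2

theorem EvRing.exists_seq {K : Type*} [Field K] (s : ℕ → K)
    (h : ∃ (N : ℕ) (c : K), ∀ n, N ≤ n → s n = c) :
    ∃ x : EvRing K, ∀ n, x.seq n = s n := ⟨(⟨s, h⟩ : evConst K), fun _ => rfl⟩

theorem evIdem_seq (K : Type*) [Field K] (i n : ℕ) :
    (evIdem K i).seq n = if n = i then 1 else 0 := rfl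

/-- The ideal of finitely supported sequences. -/
def evFin (K : Type*) [Field K] : Ideal (EvRing K) where
  carrier := {x | ∃ N : ℕ, ∀ n, N ≤ n → x.seq n = 0}
  zero_mem' := ⟨0, fun _ _ => rfl⟩
  add_mem' := by
    rintro x y ⟨N, hN⟩ ⟨M, hM⟩
    exact ⟨max N M, fun n hn => by
      rw [EvRing.seq_add, hN n (le_trans (le_max_left N M) hn),
        hM n (le_trans (le_max_right N M) hn), add_zero]⟩
  smul_mem' := by
    rintro r x ⟨N, hN⟩
    exact ⟨N, fun n hn => by rw [smul_eq_mul, EvRing.seq_mul, hN n hn, mul_zero]⟩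

theorem mem_evFin {K : Type*} [Field K] {x : EvRing K} :
    x ∈ evFin K ↔ ∃ N : ℕ, ∀ n, N ≤ n → x.seq n = 0 := Iff.rfl

/-- Modules killed by the finitely supported sequences are injective. -/
theorem evFin_baer (K : Type*) [Field K] (Q : Type*) [AddCommGroup Q] [Module (EvRing K) Q]
    (hQ : ∀ s ∈ evFin K, ∀ q : Q, s • q = 0) : Module.Baer (EvRing K) Q := by
  intro J f
  by_cases hJ : J ≤ evFin K
  · refine ⟨0, fun x hx => ?_⟩
    obtain ⟨N, hN⟩ := mem_evFin.1 (hJ hx)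
    obtain ⟨e, he⟩ := EvRing.exists_seq (K := K) (fun n => if n < N then 1 else 0)
      ⟨N, 0, fun n hn => if_neg (by omega)⟩
    have heS : e ∈ evFin K := ⟨N, fun n hn => by rw [he, if_neg (by omega)]⟩
    have hex : (⟨x, hx⟩ : J) = e • ⟨x, hx⟩ := by
      apply Subtype.ext
      refine EvRing.ext' fun n => ?_
      change x.seq n = (e * x).seq n
      rw [EvRing.seq_mul, he]
      split_ifs with h
      · rw [one_mul]
      · rw [hN n (by omega), zero_mul]
    rw [hex, map_smul, hQ e heS]
    rfl
  · obtain ⟨x, hx, hxS⟩ := Set.not_subset.1 hJ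
    obtain ⟨N, c, hc⟩ := x.exists_const
    have hc0 : c ≠ 0 := by
      rintro rfl
      exact hxS ⟨N, hc⟩
    obtain ⟨y, hy⟩ := EvRing.exists_seq (K := K) (fun _ => c⁻¹) ⟨0, c⁻¹, fun _ _ => rfl⟩
    have he : y * x ∈ J := J.mul_mem_left y hx
    have hS : 1 - y * x ∈ evFin K := ⟨N, fun n hn => by
      rw [EvRing.seq_sub, EvRing.seq_one, EvRing.seq_mul, hy, hc n hn, inv_mul_cancel₀ hc0,
        sub_self]⟩
    refine ⟨LinearMap.toSpanSingleton _ _ (f ⟨y * x, he⟩), fun j hj => ?_⟩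
    have h1 := hQ _ hS (f ⟨j, hj⟩)
    rw [sub_smul, one_smul, sub_eq_zero] at h1
    rw [LinearMap.toSpanSingleton_apply, h1, ← map_smul, ← map_smul]
    congr 1
    exact Subtype.ext (mul_comm _ _)

/-- A finitely supported sequence whose supporting idempotents lie in `I` lies in `I`. -/
theorem mem_of_idem {K : Type*} [Field K] (I : Ideal (EvRing K)) (N : ℕ) :
    ∀ x : EvRing K, (∀ n, N ≤ n → x.seq n = 0) →
      (∀ i, x.seq i ≠ 0 → evIdem K i ∈ I) → x ∈ I := by
  induction N with
  | zero =>
    intro x hx _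
    have : x = 0 := EvRing.ext' fun n => hx n (Nat.zero_le _)
    rw [this]; exact I.zero_mem
  | succ N ih =>
    intro x hx hI
    have h1 : x * evIdem K N ∈ I := by
      by_cases h : x.seq N = 0
      · have : x * evIdem K N = 0 := EvRing.ext' fun n => by
          rw [EvRing.seq_mul, evIdem_seq, EvRing.seq_zero]
          split_ifs with hn
          · rw [hn, h, zero_mul]
          · rw [mul_zero]
        rw [this]; exact I.zero_mem
      · exact I.mul_mem_left _ (hI N h)
    have hs : ∀ n, (x - x * evIdem K N).seq n = if n = N then 0 else x.seq n := by
      intro n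
      rw [EvRing.seq_sub, EvRing.seq_mul, evIdem_seq]
      split_ifs <;> simp
    have h2 : x - x * evIdem K N ∈ I := by
      apply ih
      · intro n hn
        rw [hs]
        split_ifs with h
        · rfl
        · exact hx n (by omega)
      · intro i hi
        rw [hs] at hi
        split_ifs at hi with h
        · exact absurd rfl hi
        · exact hI i hi
    have := I.add_mem h1 h2
    rwa [add_sub_cancel] at this

/-- The map `S → R` splitting `S → S / (S ∩ I)`. -/
theorem exists_split {K : Type*} [Field K] (I : Ideal (EvRing K)) :
    ∃ φ : evFin K →ₗ[EvRing K] EvRing K,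
      (∀ s : evFin K, (s : EvRing K) - φ s ∈ I) ∧ ∀ s : evFin K, (s : EvRing K) ∈ I → φ s = 0 := by
  classical
  have key : ∀ s : evFin K, ∃ x : EvRing K,
      ∀ n, x.seq n = if evIdem K n ∈ I then 0 else (s : EvRing K).seq n := by
    rintro ⟨s, N, hN⟩
    refine EvRing.exists_seq _ ⟨N, 0, fun n hn => ?_⟩
    split_ifs
    · rfl
    · exact hN n hn
  choose φ hφ using key
  refine ⟨⟨⟨φ, ?_⟩, ?_⟩, ?_, ?_⟩
  · intro s t
    refine EvRing.ext' fun n => ?_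
    rw [EvRing.seq_add, hφ, hφ, hφ]
    split_ifs
    · rw [add_zero]
    · rfl
  · intro r s
    refine EvRing.ext' fun n => ?_
    change (φ (r • s)).seq n = (r * φ s).seq n
    rw [EvRing.seq_mul, hφ, hφ]
    split_ifs
    · rw [mul_zero]
    · rfl
  · intro s
    change (s : EvRing K) - φ s ∈ I
    obtain ⟨N, hN⟩ := mem_evFin.1 s.2
    have hs : ∀ n, ((s : EvRing K) - φ s).seq n =
        if evIdem K n ∈ I then (s : EvRing K).seq n else 0 := by
      intro n
      rw [EvRing.seq_sub, hφ]
      split_ifs <;> simp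
    apply mem_of_idem I N
    · intro n hn
      rw [hs, hN n hn, ite_self]
    · intro i hi
      rw [hs] at hi
      by_contra h
      exact hi (if_neg h)
  · intro s hs
    change φ s = 0
    refine EvRing.ext' fun n => ?_
    rw [hφ, EvRing.seq_zero]
    split_ifs with h
    · rfl
    · by_contra h0
      apply h
      obtain ⟨y, hy⟩ := EvRing.exists_seq (K := K)
        (fun m => if m = n then ((s : EvRing K).seq n)⁻¹ else 0)
        ⟨n + 1, 0, fun m hm => if_neg (by omega)⟩
      have : evIdem K n = y * s := EvRing.ext' fun m => by
        rw [EvRing.seq_mul, hy, evIdem_seq]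
        split_ifs with hm
        · rw [hm, inv_mul_cancel₀ h0]
        · rw [zero_mul]
      rw [this]
      exact I.mul_mem_left _ hs

/-- Over the ring `R` of eventually constant sequences, the class of `R`-projective modules
is closed under submodules. -/
theorem evRing_rProjective_submodule (K : Type*) [Field K]
    (M : Type v) [AddCommGroup M] [Module (EvRing K) M]
    (hM : IsRProjective (EvRing K) M) (N : Submodule (EvRing K) M) :
    IsRProjective (EvRing K) N := by
  intro I f
  obtain ⟨φ, hφ1, hφ2⟩ := exists_split I
  have hB : Module.Baer (EvRing K) (EvRing K ⧸ (I ⊔ evFin K)) := by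
    apply evFin_baer
    intro s hs q
    obtain ⟨r, rfl⟩ := Submodule.mkQ_surjective _ q
    rw [← map_smul, Submodule.mkQ_apply, Submodule.Quotient.mk_eq_zero]
    exact Ideal.mul_mem_right _ _ ((le_sup_right : evFin K ≤ I ⊔ evFin K) hs)
  let p : (EvRing K ⧸ I) →ₗ[EvRing K] (EvRing K ⧸ (I ⊔ evFin K)) :=
    Submodule.factor (le_sup_left : I ≤ I ⊔ evFin K)
  obtain ⟨F, hF⟩ := hB.extension_property N.subtype N.injective_subtype (p.comp f)
  obtain ⟨g, hg⟩ := hM _ F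
  let q : evFin K →ₗ[EvRing K] EvRing K ⧸ I := I.mkQ.comp (evFin K).subtype
  have hr : ∀ x, (f - I.mkQ.comp (g.comp N.subtype)) x ∈ LinearMap.range q := by
    intro x
    obtain ⟨r, hr⟩ := Submodule.mkQ_surjective I (f x)
    have h1 : (I ⊔ evFin K).mkQ r = (I ⊔ evFin K).mkQ (g x) := by
      have h2 : F x = p (f x) := LinearMap.congr_fun hF x
      rw [← hr, hg] at h2
      exact h2.symm
    rw [← sub_eq_zero, ← map_sub, Submodule.mkQ_apply, Submodule.Quotient.mk_eq_zero] at h1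
    obtain ⟨a, ha, b, hb, hab⟩ := Submodule.mem_sup.1 h1
    refine ⟨⟨b, hb⟩, ?_⟩
    change I.mkQ b = f x - I.mkQ (g x)
    rw [← hr, ← map_sub, ← hab, map_add, (Submodule.Quotient.mk_eq_zero I).2 ha |>
      (Submodule.mkQ_apply I a).trans, zero_add]
  have hk : LinearMap.ker q ≤ LinearMap.ker φ := by
    intro s hs
    exact hφ2 s ((Submodule.Quotient.mk_eq_zero I).1 hs)
  let h : N →ₗ[EvRing K] EvRing K :=
    ((LinearMap.ker q).liftQ φ hk).comp
      (q.quotKerEquivRange.symm.toLinearMap.comp (LinearMap.codRestrict _ _ hr))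
  refine ⟨g.comp N.subtype + h, LinearMap.ext fun x => ?_⟩
  have hh : I.mkQ (h x) = f x - I.mkQ (g x) := by
    obtain ⟨s, hs⟩ := hr x
    have e1 : h x = φ s := by
      have : LinearMap.codRestrict _ _ hr x = q.quotKerEquivRange ((LinearMap.ker q).mkQ s) :=
        Subtype.ext hs.symm
      change ((LinearMap.ker q).liftQ φ hk)
        (q.quotKerEquivRange.symm (LinearMap.codRestrict _ _ hr x)) = φ s
      rw [this, LinearEquiv.symm_apply_apply]
      rfl
    have e2 : I.mkQ (s : EvRing K) = I.mkQ (φ s) := (Submodule.Quotient.eq I).2 (hφ1 s)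
    rw [e1, ← e2]
    exact hs
  change f x = I.mkQ (g x + h x)
  rw [map_add, hh, add_sub_cancel]
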